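/- arXiv:1606.00324 — 4 statements merged into one kernel-verified Lean document; each statement's English description precedes it below -/
import Mathlib

section
/- For any hypergraph communication situation (N,v,H) and any two players i,j∈N: Σ_{e∈H_j}(1/|e|)·[π_i(N,v,H)−π_i(N,v,H\{e})] = (1/η(H))·Σ_{∅≠K⊆U(H)} λ_K(w)·|K_i|·|K_j|/|K|, where K_i=K∩U(H)(i) and K_j=K∩U(H)(j); in particular this expression is symmetric in i and j. -/
open scoped Classical
open Finset

noncomputable section

namespace HGGame

/-! ## Generic hypergraph notions -/

variable {α : Type*}

/-- Two nodes are linked if they lie in a common hyperlink of `E`. -/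
def Linked (E : Finset (Finset α)) (a b : α) : Prop :=
  ∃ e ∈ E, a ∈ e ∧ b ∈ e

/-- The component of `i` in the subhypergraph of `(α, E)` induced by the ground set `S`
(only hyperlinks contained in `S` count). -/
def compOf (E : Finset (Finset α)) (S : Finset α) (i : α) : Finset α :=
  S.filter (fun j => Relation.ReflTransGen (Linked (E.filter (fun e => e ⊆ S))) i j)

/-- The set `S/E` of components of the subhypergraph induced by `S`. -/
def components (E : Finset (Finset α)) (S : Finset α) : Finset (Finset α) :=
  S.image (compOf E S)

/-- The hypergraph-restricted worth `v^E(S) = Σ_{T ∈ S/E} v(T)`. -/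
def restrictedWorth (v : Finset α → ℝ) (E : Finset (Finset α)) (S : Finset α) : ℝ :=
  ∑ T ∈ components E S, v T

/-! ## Shapley value -/

/-- The set `σ^i` of players preceding `i` in the ordering `σ`. -/
def preceding {M : Type*} [Fintype M] (σ : M ≃ Fin (Fintype.card M)) (i : M) : Finset M :=
  Finset.univ.filter (fun j => σ j < σ i)

/-- The marginal contribution `m^σ_i(u) = u(σ^i ∪ {i}) - u(σ^i)`. -/
def marginal {M : Type*} [Fintype M] (u : Finset M → ℝ) (σ : M ≃ Fin (Fintype.card M))
    (i : M) : ℝ :=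
  u (insert i (preceding σ i)) - u (preceding σ i)

/-- The Shapley value of the TU-game `(M, u)`. -/
def shapley {M : Type*} [Fintype M] (u : Finset M → ℝ) (i : M) : ℝ :=
  ((Fintype.card M).factorial : ℝ)⁻¹ * ∑ σ : M ≃ Fin (Fintype.card M), marginal u σ i

/-- The Harsanyi dividend `λ_T(u) = Σ_{∅ ≠ S ⊆ T} (-1)^{|T|-|S|} u(S)`. -/
def dividend {M : Type*} (u : Finset M → ℝ) (T : Finset M) : ℝ :=
  ∑ S ∈ T.powerset.filter (fun S => S ≠ ∅), (-1 : ℝ) ^ (T.card - S.card) * u S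

/-! ## Hypergraph communication situations -/

variable {N : Type*} [Fintype N] [DecidableEq N]

/-- The conference game `(H, v^N)`, a TU-game with player set `H`:
`v^N(H') = Σ_{T ∈ N/H'} v(T)`. -/
def confGame (v : Finset N → ℝ) (H : Finset (Finset N)) (F : Finset {e // e ∈ H}) : ℝ :=
  restrictedWorth v (F.image Subtype.val) Finset.univ

/-- The position value `π_i(N,v,H) = Σ_{e ∈ H_i} (1/|e|) · Sh_e(H, v^N)`. -/
def positionValue (v : Finset N → ℝ) (H : Finset (Finset N)) (i : N) : ℝ :=
  ∑ e ∈ H.attach.filter (fun e => i ∈ e.val),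
    ((e.val.card : ℝ))⁻¹ * shapley (confGame v H) e

/-! ## The uniform hyperlink game -/

/-- The type of agents `(i, e, k)` of the uniform hyperlink game. -/
abbrev UElem (N : Type*) := N × Finset N × ℕ

/-- `η(H)`: the least common multiple of the hyperlink sizes. -/
def eta (H : Finset (Finset N)) : ℕ := H.lcm Finset.card

/-- `U(H)(i,e) = {(i,e,k) : k = 1, …, η(H)/|e|}`. -/
def UHie (H : Finset (Finset N)) (i : N) (e : Finset N) : Finset (UElem N) :=
  (Finset.Icc 1 (eta H / e.card)).image fun k => (i, e, k)

/-- `U(H)(i) = ∪_{e ∈ H_i} U(H)(i,e)`. -/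
def UHi (H : Finset (Finset N)) (i : N) : Finset (UElem N) :=
  (H.filter (fun e => i ∈ e)).biUnion fun e => UHie H i e

/-- `U(H)(e) = ∪_{i ∈ e} U(H)(i,e)`. -/
def UHe (H : Finset (Finset N)) (e : Finset N) : Finset (UElem N) :=
  e.biUnion fun i => UHie H i e

/-- `U(H) = ∪_{i ∈ N} U(H)(i)`. -/
def UH (H : Finset (Finset N)) : Finset (UElem N) :=
  Finset.univ.biUnion fun i : N => UHi H i

/-- `H[S] = {e ∈ H : U(H)(e) ⊆ S}`. -/
def Hof (H : Finset (Finset N)) (S : Finset (UElem N)) : Finset (Finset N) :=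
  H.filter fun e => UHe H e ⊆ S

/-- The characteristic function `w(S) = Σ_{R ∈ N/H[S]} v(R)` of the uniform hyperlink game. -/
def uw (v : Finset N → ℝ) (H : Finset (Finset N)) (S : Finset (UElem N)) : ℝ :=
  restrictedWorth v (Hof H S) Finset.univ

/-- The uniform hyperlink game `(U(H), w)` as a TU-game with player set `U(H)`. -/
def uGame (v : Finset N → ℝ) (H : Finset (Finset N)) (F : Finset {l // l ∈ UH H}) : ℝ :=
  uw v H (F.image Subtype.val)

/-! ## Harsanyi dividends and unanimity representations -/

section Games

variable {M ι : Type*}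

lemma sum_neg_one_pow_card_between (A K : Finset M) :
    ∑ S ∈ K.powerset, (if A ⊆ S then (-1 : ℝ) ^ S.card else 0)
      = if A = K then (-1 : ℝ) ^ K.card else 0 := by
  by_cases hA : A ⊆ K
  · have hfilter : K.powerset.filter (A ⊆ ·) = (K \ A).powerset.image (A ∪ ·) := by
      rw [← Finset.Icc_eq_image_powerset hA]
      ext S
      simp [and_comm]
    have hdisj : ∀ S ∈ (K \ A).powerset, Disjoint A S := fun S hS =>
      disjoint_of_subset_right (mem_powerset.1 hS) disjoint_sdiff
    rw [← sum_filter, hfilter, sum_image]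
    · have hsum : ∑ S ∈ (K \ A).powerset, (-1 : ℝ) ^ S.card
          = if K \ A = ∅ then 1 else 0 := by
        have h := Finset.sum_powerset_neg_one_pow_card (x := K \ A)
        exact_mod_cast congrArg (Int.cast : ℤ → ℝ) h
      rw [sum_congr rfl fun S hS => by rw [card_union_of_disjoint (hdisj S hS), pow_add],
        ← mul_sum, hsum]
      by_cases h : A = K
      · simp [h]
      · have : ¬ K \ A = ∅ := fun h' => h (hA.antisymm (sdiff_eq_empty_iff_subset.1 h'))
        simp [h, this]
    · intro S hS T hT hST
      have := congrArg (· \ A) hST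
      simpa [union_sdiff_distrib, (hdisj S hS).symm.sdiff_eq_left,
        (hdisj T hT).symm.sdiff_eq_left] using this
  · rw [if_neg fun h => hA h.subset]
    refine sum_eq_zero fun S hS => if_neg fun h => hA (h.trans (mem_powerset.1 hS))

lemma dividend_eq_sum_powerset {u : Finset M → ℝ} (hu0 : u ∅ = 0) (K : Finset M) :
    dividend u K = ∑ S ∈ K.powerset, (-1 : ℝ) ^ K.card * ((-1 : ℝ) ^ S.card * u S) := by
  unfold dividend
  rw [sum_filter]
  refine sum_congr rfl fun S hS => ?_
  split_ifs with h
  · have hcard := card_le_card (mem_powerset.1 hS)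
    rw [← mul_assoc, ← pow_add,
      show K.card + S.card = K.card - S.card + 2 * S.card by omega, pow_add, pow_mul]
    simp
  · rw [not_not.1 h, hu0]
    simp

lemma eq_sum_dividend {u : Finset M → ℝ} (hu0 : u ∅ = 0) (F : Finset M) :
    u F = ∑ G ∈ F.powerset, dividend u G := by
  have hG : ∀ G ∈ F.powerset, dividend u G = ∑ S ∈ F.powerset,
      ((-1 : ℝ) ^ S.card * u S) * (if S ⊆ G then (-1 : ℝ) ^ G.card else 0) := by
    intro G hG
    rw [dividend_eq_sum_powerset hu0]
    have : G.powerset = F.powerset.filter (· ⊆ G) := by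
      ext S
      simp only [mem_powerset, mem_filter]
      exact ⟨fun h => ⟨h.trans (mem_powerset.1 hG), h⟩, fun h => h.2⟩
    rw [this, sum_filter]
    refine sum_congr rfl fun S _ => ?_
    split_ifs <;> ring
  rw [sum_congr rfl hG, sum_comm]
  simp_rw [← mul_sum, sum_neg_one_pow_card_between, mul_ite, mul_zero]
  rw [sum_ite_eq' F.powerset F, if_pos (mem_powerset_self F), mul_right_comm, ← mul_pow]
  simp

/-- `u` is the linear combination `Σ_{x ∈ P} c x · u_{g x}` of unanimity games. -/
def IsUnanimitySum (u : Finset M → ℝ) (P : Finset ι) (c : ι → ℝ) (g : ι → Finset M) : Prop :=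
  ∀ F, u F = ∑ x ∈ P, if g x ⊆ F then c x else 0

/-- The dividends of a linear combination of unanimity games. -/
lemma dividend_of_unanimity_sum {P : Finset ι} {c : ι → ℝ} {g : ι → Finset M}
    {u : Finset M → ℝ} (hu : IsUnanimitySum u P c g)
    (hu0 : u ∅ = 0) (K : Finset M) :
    dividend u K = ∑ x ∈ P, if g x = K then c x else 0 := by
  rw [dividend_eq_sum_powerset hu0]
  simp_rw [hu _, mul_sum]
  rw [sum_comm]
  refine sum_congr rfl fun x _ => ?_
  have hS : ∀ S ∈ K.powerset,
      (-1 : ℝ) ^ K.card * ((-1 : ℝ) ^ S.card * (if g x ⊆ S then c x else 0))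
        = ((-1 : ℝ) ^ K.card * c x) * (if g x ⊆ S then (-1 : ℝ) ^ S.card else 0) := by
    intro S _
    split_ifs <;> ring
  rw [sum_congr rfl hS, ← mul_sum, sum_neg_one_pow_card_between]
  split_ifs
  · rw [mul_right_comm, ← mul_pow]
    simp
  · simp

variable [Fintype M]

/-- The orderings in which `e` comes last among `T` are a fraction `1 / |T|` of all orderings. -/
lemma card_mul_card_orderings_last (T : Finset M) {e : M} (he : e ∈ T) :
    T.card * (univ.filter fun σ : M ≃ Fin (Fintype.card M) => ∀ y ∈ T, σ y ≤ σ e).card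
      = (Fintype.card M).factorial := by
  have hswap : ∀ e' ∈ T,
      (univ.filter fun σ : M ≃ Fin (Fintype.card M) => ∀ y ∈ T, σ y ≤ σ e').card
        = (univ.filter fun σ : M ≃ Fin (Fintype.card M) => ∀ y ∈ T, σ y ≤ σ e).card := by
    intro e' he'
    have hmem : ∀ y ∈ T, Equiv.swap e e' y ∈ T := by
      intro y hy
      rw [Equiv.swap_apply_def]
      split_ifs <;> assumption
    refine card_bij' (fun σ _ => (Equiv.swap e e').trans σ)
      (fun σ _ => (Equiv.swap e e').trans σ) ?_ ?_ ?_ ?_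
    · intro σ hσ
      simp only [mem_filter, mem_univ, true_and] at hσ ⊢
      intro y hy
      simpa using hσ _ (hmem y hy)
    · intro σ hσ
      simp only [mem_filter, mem_univ, true_and] at hσ ⊢
      intro y hy
      simpa using hσ _ (hmem y hy)
    · intro σ _
      ext y
      simp
    · intro σ _
      ext y
      simp
  have hcard : (Fintype.card M).factorial
      = (univ : Finset (M ≃ Fin (Fintype.card M))).card := by
    rw [card_univ, Fintype.card_equiv (Fintype.equivFin M)]
  have hpart : (univ : Finset (M ≃ Fin (Fintype.card M)))
      = T.biUnion fun e' => univ.filter fun σ => ∀ y ∈ T, σ y ≤ σ e' := by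
    ext σ
    simpa using T.exists_max_image σ ⟨e, he⟩
  rw [hcard, ← smul_eq_mul, ← sum_const, ← sum_congr rfl hswap, ← card_biUnion, ← hpart]
  intro a ha b hb hab
  refine disjoint_left.2 fun σ hσa hσb => hab ?_
  simp only [mem_filter, mem_univ, true_and] at hσa hσb
  exact σ.injective (le_antisymm (hσb a ha) (hσa b hb))

/-- The Shapley value of a linear combination of unanimity games. -/
lemma shapley_of_unanimity_sum {P : Finset ι} {c : ι → ℝ} {g : ι → Finset M}
    {u : Finset M → ℝ} (hu : IsUnanimitySum u P c g) (e : M) :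
    shapley u e = ∑ x ∈ P, if e ∈ g x then c x / (g x).card else 0 := by
  have hmarg : ∀ σ : M ≃ Fin (Fintype.card M), marginal u σ e
      = ∑ x ∈ P, if e ∈ g x then c x * (if ∀ y ∈ g x, σ y ≤ σ e then 1 else 0) else 0 := by
    intro σ
    unfold marginal
    rw [hu, hu, ← sum_sub_distrib]
    refine sum_congr rfl fun x _ => ?_
    by_cases he : e ∈ g x
    · have h1 : ¬ g x ⊆ preceding σ e := fun h => by simpa [preceding] using h he
      have h2 : g x ⊆ insert e (preceding σ e) ↔ ∀ y ∈ g x, σ y ≤ σ e := by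
        refine forall₂_congr fun y _ => ?_
        simp only [preceding, mem_insert, mem_filter, mem_univ, true_and]
        rw [le_iff_eq_or_lt, σ.injective.eq_iff]
      simp [he, h1, h2]
    · simp [he, subset_insert_iff_of_notMem he]
  unfold shapley
  rw [sum_congr rfl fun σ _ => hmarg σ, sum_comm, mul_sum]
  refine sum_congr rfl fun x _ => ?_
  split_ifs with he
  · have hcount := card_mul_card_orderings_last (g x) he
    rw [← mul_sum, sum_boole, ← hcount]
    have hne : (g x).card * (univ.filter fun σ : M ≃ Fin (Fintype.card M) =>
        ∀ y ∈ g x, σ y ≤ σ e).card ≠ 0 := hcount ▸ Nat.factorial_ne_zero _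
    have h1 : ((g x).card : ℝ) ≠ 0 := by exact_mod_cast (mul_ne_zero_iff.1 hne).1
    have h2 : ((univ.filter fun σ : M ≃ Fin (Fintype.card M) =>
        ∀ y ∈ g x, σ y ≤ σ e).card : ℝ) ≠ 0 := by exact_mod_cast (mul_ne_zero_iff.1 hne).2
    push_cast
    field_simp
  · simp

end Games

/-! ## Dividend formulas for hypergraph games -/

/-- The worth `Σ_{T ∈ N/E} v(T)` as a set function on hyperlink families. -/
def linkWorth (v : Finset N → ℝ) (E : Finset (Finset N)) : ℝ :=
  restrictedWorth v E univ

/-- The total weight `Σ_{e ∈ G, i ∈ e} 1/|e|` of `i` in a hyperlink family. -/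
def weight (G : Finset (Finset N)) (i : N) : ℝ :=
  ∑ e ∈ G.filter (fun e => i ∈ e), (e.card : ℝ)⁻¹

lemma linkWorth_empty {v : Finset N → ℝ} (hzn : ∀ i : N, v {i} = 0) :
    linkWorth v ∅ = 0 := by
  unfold linkWorth restrictedWorth components
  refine sum_eq_zero fun T hT => ?_
  simp only [mem_image, mem_univ, true_and] at hT
  obtain ⟨a, rfl⟩ := hT
  have : compOf (∅ : Finset (Finset N)) univ a = {a} := by
    ext b
    simp only [compOf, filter_empty, mem_filter, mem_univ, true_and, mem_singleton]
    refine ⟨fun h => ?_, fun h => h ▸ Relation.ReflTransGen.refl⟩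
    obtain h | ⟨c, -, e, he, -⟩ := h.cases_tail
    · exact h
    · simp at he
  rw [this, hzn]

lemma linkWorth_eq_sum {v : Finset N → ℝ} (hzn : ∀ i : N, v {i} = 0)
    {E H : Finset (Finset N)} (hE : E ⊆ H) :
    linkWorth v E = ∑ G ∈ H.powerset, if G ⊆ E then dividend (linkWorth v) G else 0 := by
  rw [eq_sum_dividend (linkWorth_empty hzn) E, ← sum_filter]
  congr 1
  ext G
  simp only [mem_powerset, mem_filter]
  exact ⟨fun h => ⟨h.trans hE, h⟩, fun h => h.2⟩

lemma subtype_subset_iff_subset_image {A : Type*} [DecidableEq A] {S X : Finset A}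
    (hX : X ⊆ S) (F : Finset {a // a ∈ S}) :
    X.subtype (· ∈ S) ⊆ F ↔ X ⊆ F.image Subtype.val := by
  constructor
  · intro h a ha
    exact mem_image.2 ⟨⟨a, hX ha⟩, h (by simpa using ha), rfl⟩
  · intro h a ha
    obtain ⟨b, hb, hba⟩ := mem_image.1 (h (by simpa using ha))
    exact Subtype.ext hba ▸ hb

lemma card_subtype_of_subset {A : Type*} [DecidableEq A] {S X : Finset A} (hX : X ⊆ S) :
    (X.subtype (· ∈ S)).card = X.card := by
  rw [card_subtype, filter_true_of_mem fun a ha => hX ha]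

lemma isUnanimitySum_confGame {v : Finset N → ℝ} (hzn : ∀ i : N, v {i} = 0)
    (H : Finset (Finset N)) :
    IsUnanimitySum (confGame v H) H.powerset (dividend (linkWorth v))
      (fun G => G.subtype (· ∈ H)) := by
  intro F
  have hF : F.image Subtype.val ⊆ H := by
    intro e he
    obtain ⟨e', -, rfl⟩ := mem_image.1 he
    exact e'.2
  refine (linkWorth_eq_sum hzn hF).trans (sum_congr rfl fun G hG => ?_)
  congr 1
  exact propext (subtype_subset_iff_subset_image (mem_powerset.1 hG) F).symm

lemma positionValue_eq_sum {v : Finset N → ℝ} (hzn : ∀ i : N, v {i} = 0)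
    (H : Finset (Finset N)) (i : N) :
    positionValue v H i
      = ∑ G ∈ H.powerset, dividend (linkWorth v) G / G.card * weight G i := by
  unfold positionValue
  simp_rw [shapley_of_unanimity_sum (isUnanimitySum_confGame hzn H), mul_sum]
  rw [sum_comm]
  refine sum_congr rfl fun G hG => ?_
  have hGH := mem_powerset.1 hG
  rw [card_subtype_of_subset hGH, weight, mul_sum, eq_comm]
  have hset : G.filter (fun e => i ∈ e)
      = (H.attach.filter (fun e => i ∈ e.val ∧ e.val ∈ G)).image Subtype.val := by
    ext e
    simp only [mem_filter, mem_image, mem_attach, true_and, Subtype.exists, exists_and_right,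
      exists_eq_right]
    exact ⟨fun h => ⟨⟨hGH h.1, h.2⟩, h.1⟩, fun ⟨⟨_, h⟩, h'⟩ => ⟨h', h⟩⟩
  rw [hset, sum_image Subtype.val_injective.injOn, ← filter_filter, sum_filter]
  refine sum_congr rfl fun e _ => ?_
  simp only [mem_subtype]
  split_ifs <;> ring

lemma positionValue_sub_erase {v : Finset N → ℝ} (hzn : ∀ i : N, v {i} = 0)
    {H : Finset (Finset N)} (e : Finset N) (i : N) :
    positionValue v H i - positionValue v (H.erase e) i
      = ∑ G ∈ H.powerset,
        if e ∈ G then dividend (linkWorth v) G / G.card * weight G i else 0 := by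
  have herase : (H.erase e).powerset = H.powerset.filter (e ∉ ·) := by
    ext G
    simp [subset_erase]
  rw [positionValue_eq_sum hzn, positionValue_eq_sum hzn, herase, sum_filter,
    ← sum_sub_distrib]
  refine sum_congr rfl fun G _ => ?_
  by_cases h : e ∈ G <;> simp [h]

lemma partial_contributions_eq_sum {v : Finset N → ℝ} (hzn : ∀ i : N, v {i} = 0)
    (H : Finset (Finset N)) (i j : N) :
    ∑ e ∈ H.filter (fun e => j ∈ e), (e.card : ℝ)⁻¹ *
        (positionValue v H i - positionValue v (H.erase e) i)
      = ∑ G ∈ H.powerset,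
        dividend (linkWorth v) G * weight G i * weight G j / G.card := by
  simp_rw [positionValue_sub_erase hzn, mul_sum]
  rw [sum_comm]
  refine sum_congr rfl fun G hG => ?_
  have hfilter : G.filter (fun e => j ∈ e)
      = (H.filter (fun e => j ∈ e)).filter (· ∈ G) := by
    ext e
    simp only [mem_filter]
    exact ⟨fun h => ⟨⟨mem_powerset.1 hG h.1, h.2⟩, h.1⟩, fun h => ⟨h.2, h.1.2⟩⟩
  simp_rw [mul_ite, mul_zero]
  rw [← sum_filter, ← hfilter, ← sum_mul]
  change weight G j * _ = _
  ring

/-! ## The uniform hyperlink game -/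

lemma mem_UHie {H : Finset (Finset N)} {i : N} {e : Finset N} {l : UElem N} :
    l ∈ UHie H i e ↔ l.1 = i ∧ l.2.1 = e ∧ 1 ≤ l.2.2 ∧ l.2.2 ≤ eta H / e.card := by
  obtain ⟨a, b, k⟩ := l
  simp only [UHie, mem_image, mem_Icc, Prod.mk.injEq]
  constructor
  · rintro ⟨k, hk, rfl, rfl, rfl⟩
    exact ⟨rfl, rfl, hk⟩
  · rintro ⟨rfl, rfl, hk⟩
    exact ⟨k, hk, rfl, rfl, rfl⟩

lemma mem_UHe {H : Finset (Finset N)} {e : Finset N} {l : UElem N} :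
    l ∈ UHe H e ↔ l.1 ∈ e ∧ l ∈ UHie H l.1 e := by
  simp only [UHe, mem_biUnion]
  constructor
  · rintro ⟨a, ha, hl⟩
    obtain rfl := (mem_UHie.1 hl).1
    exact ⟨ha, hl⟩
  · exact fun h => ⟨_, h⟩

lemma mem_UHi {H : Finset (Finset N)} {i : N} {l : UElem N} :
    l ∈ UHi H i ↔ ∃ e ∈ H, i ∈ e ∧ l ∈ UHie H i e := by
  simp [UHi, and_assoc]

lemma card_UHie (H : Finset (Finset N)) (i : N) (e : Finset N) :
    (UHie H i e).card = eta H / e.card := by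
  rw [UHie, card_image_of_injective, Nat.card_Icc, Nat.add_sub_cancel]
  intro a b h
  simpa using h

lemma card_dvd_eta {H : Finset (Finset N)} {e : Finset N} (he : e ∈ H) :
    e.card ∣ eta H :=
  dvd_lcm he

lemma card_UHe {H : Finset (Finset N)} {e : Finset N} (he : e ∈ H) :
    (UHe H e).card = eta H := by
  rw [UHe, card_biUnion, sum_congr rfl fun i _ => card_UHie H i e, sum_const, smul_eq_mul,
    Nat.mul_div_cancel' (card_dvd_eta he)]
  intro a _ b _ hab
  refine disjoint_left.2 fun l hla hlb => hab ?_
  rw [← (mem_UHie.1 hla).1, (mem_UHie.1 hlb).1]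

/-- The agents `∪_{e ∈ G} U(H)(e)` belonging to the hyperlinks of `G`. -/
def agents (H G : Finset (Finset N)) : Finset (UElem N) :=
  G.biUnion (UHe H)

lemma agents_subset_UH {H G : Finset (Finset N)} (hG : G ⊆ H) : agents H G ⊆ UH H := by
  intro l hl
  obtain ⟨e, he, hl⟩ := mem_biUnion.1 hl
  obtain ⟨h1, h2⟩ := mem_UHe.1 hl
  exact mem_biUnion.2 ⟨l.1, mem_univ _, mem_UHi.2 ⟨e, hG he, h1, h2⟩⟩

lemma card_agents {H G : Finset (Finset N)} (hG : G ⊆ H) :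
    (agents H G).card = eta H * G.card := by
  rw [agents, card_biUnion, sum_congr rfl fun e he => card_UHe (hG he), sum_const,
    smul_eq_mul, mul_comm]
  intro a _ b _ hab
  refine disjoint_left.2 fun l hla hlb => hab ?_
  rw [← (mem_UHie.1 (mem_UHe.1 hla).2).2.1, (mem_UHie.1 (mem_UHe.1 hlb).2).2.1]

lemma card_agents_filter {H G : Finset (Finset N)} (hH : ∀ e ∈ H, 1 < e.card)
    (hG : G ⊆ H) (i : N) :
    (((agents H G).filter (· ∈ UHi H i)).card : ℝ) = eta H * weight G i := by
  have hset : (agents H G).filter (· ∈ UHi H i)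
      = (G.filter (fun e => i ∈ e)).biUnion (UHie H i) := by
    ext l
    simp only [agents, mem_filter, mem_biUnion, mem_UHi, mem_UHe]
    constructor
    · rintro ⟨⟨e, he, hle, hl⟩, e', -, -, hl'⟩
      obtain rfl := (mem_UHie.1 hl').1
      exact ⟨e, ⟨he, hle⟩, hl⟩
    · rintro ⟨e, ⟨he, hie⟩, hl⟩
      obtain rfl := (mem_UHie.1 hl).1
      exact ⟨⟨e, he, hie, hl⟩, e, hG he, hie, hl⟩
  rw [hset, card_biUnion, weight, mul_sum, Nat.cast_sum]
  · refine sum_congr rfl fun e he => ?_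
    have heH := hG (mem_filter.1 he).1
    have hpos := hH e heH
    rw [card_UHie, Nat.cast_div (card_dvd_eta heH) (by positivity), div_eq_mul_inv]
  · intro a _ b _ hab
    refine disjoint_left.2 fun l hla hlb => hab ?_
    rw [← (mem_UHie.1 hla).2.1, (mem_UHie.1 hlb).2.1]

lemma isUnanimitySum_uGame {v : Finset N → ℝ} (hzn : ∀ i : N, v {i} = 0)
    (H : Finset (Finset N)) :
    IsUnanimitySum (uGame v H) H.powerset (dividend (linkWorth v))
      (fun G => (agents H G).subtype (· ∈ UH H)) := by
  intro F
  refine (linkWorth_eq_sum hzn (filter_subset _ H)).trans (sum_congr rfl fun G hG => ?_)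
  have hGH := mem_powerset.1 hG
  have hiff : G ⊆ Hof H (F.image Subtype.val)
      ↔ (agents H G).subtype (· ∈ UH H) ⊆ F := by
    rw [subtype_subset_iff_subset_image (agents_subset_UH hGH), agents, biUnion_subset]
    refine forall₂_congr fun e he => ?_
    simp [Hof, hGH he]
  congr 1
  exact propext hiff

lemma eta_ne_zero {H : Finset (Finset N)} (hH : ∀ e ∈ H, 1 < e.card) : eta H ≠ 0 := by
  rw [eta, Ne, Finset.lcm_eq_zero_iff]
  rintro ⟨e, he, h0⟩
  have := hH e he
  omega

lemma uGame_empty {v : Finset N → ℝ} (hzn : ∀ i : N, v {i} = 0)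
    {H : Finset (Finset N)} (hH : ∀ e ∈ H, 1 < e.card) : uGame v H ∅ = 0 := by
  have hHof : Hof H ∅ = ∅ := by
    refine filter_eq_empty_iff.2 fun e he h => eta_ne_zero hH ?_
    rw [← card_UHe he, subset_empty.1 h, card_empty]
  rw [uGame, uw, image_empty, hHof]
  exact linkWorth_empty hzn

lemma sum_dividend_uGame {v : Finset N → ℝ} (hzn : ∀ i : N, v {i} = 0)
    {H : Finset (Finset N)} (hH : ∀ e ∈ H, 1 < e.card) (i j : N) :
    (eta H : ℝ)⁻¹ *
        ∑ K ∈ (Finset.univ : Finset (Finset {l // l ∈ UH H})).filter (fun K => K ≠ ∅),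
          dividend (uGame v H) K *
            ((K.filter (fun l => l.val ∈ UHi H i)).card : ℝ) *
            ((K.filter (fun l => l.val ∈ UHi H j)).card : ℝ) / (K.card : ℝ)
      = ∑ G ∈ H.powerset,
        dividend (linkWorth v) G * weight G i * weight G j / G.card := by
  have hcard : ∀ G ⊆ H, ∀ a : N,
      ((((agents H G).subtype (· ∈ UH H)).filter (fun l => l.val ∈ UHi H a)).card : ℝ)
        = eta H * weight G a := by
    intro G hG a
    rw [← card_agents_filter hH hG a,
      ← card_subtype_of_subset ((filter_subset _ _).trans (agents_subset_UH hG))]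
    congr 2
    ext l
    simp
  have heta : (eta H : ℝ) ≠ 0 := by exact_mod_cast eta_ne_zero hH
  rw [sum_filter_of_ne (p := fun K : Finset {l // l ∈ UH H} => K ≠ ∅)
    fun K _ hK h => hK (by simp [h])]
  simp_rw [dividend_of_unanimity_sum (isUnanimitySum_uGame hzn H) (uGame_empty hzn hH), sum_mul,
    sum_div, ite_mul, zero_mul, ite_div, zero_div]
  rw [sum_comm, mul_sum]
  refine sum_congr rfl fun G hG => ?_
  have hGH := mem_powerset.1 hG
  rw [sum_eq_single_of_mem _ (mem_univ _) fun K _ hK => if_neg hK.symm, if_pos rfl, hcard G hGH, hcard G hGH,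
    card_subtype_of_subset (agents_subset_UH hGH), card_agents hGH]
  push_cast
  by_cases h0 : (G.card : ℝ) = 0
  · simp [h0]
  · field_simp

/-- The partial conference contributions of `j` towards `i` equal
`(1/η(H))·Σ_{∅≠K⊆U(H)} λ_K(w)·|K_i|·|K_j|/|K|`; in particular this quantity is
symmetric in `i` and `j`. -/
theorem partial_conference_contributions_eq_dividend_formula
    {N : Type*} [Fintype N] [DecidableEq N]
    (v : Finset N → ℝ) (H : Finset (Finset N))
    (hN : 2 ≤ Fintype.card N)
    (hv0 : v ∅ = 0) (hzn : ∀ i : N, v {i} = 0)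
    (hH : ∀ e ∈ H, 1 < e.card) (i j : N) :
    (∑ e ∈ H.filter (fun e => j ∈ e), (e.card : ℝ)⁻¹ *
        (positionValue v H i - positionValue v (H.erase e) i)
      = (eta H : ℝ)⁻¹ *
        ∑ K ∈ (Finset.univ : Finset (Finset {l // l ∈ UH H})).filter (fun K => K ≠ ∅),
          dividend (uGame v H) K *
            ((K.filter (fun l => l.val ∈ UHi H i)).card : ℝ) *
            ((K.filter (fun l => l.val ∈ UHi H j)).card : ℝ) / (K.card : ℝ))
    ∧ ∑ e ∈ H.filter (fun e => j ∈ e), (e.card : ℝ)⁻¹ *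
        (positionValue v H i - positionValue v (H.erase e) i)
      = ∑ e ∈ H.filter (fun e => i ∈ e), (e.card : ℝ)⁻¹ *
        (positionValue v H j - positionValue v (H.erase e) j) := by
  rw [sum_dividend_uGame hzn hH]
  refine ⟨partial_contributions_eq_sum hzn H i j, ?_⟩
  rw [partial_contributions_eq_sum hzn, partial_contributions_eq_sum hzn]
  exact sum_congr rfl fun G _ => by ring

end HGGame
end
end

section
/- The position value is the unique allocation rule on hypergraph communication situations satisfying component efficiency and partial balanced conference contributions: if an allocation rule f assigns to every hypergraph game (N,v,H) (for a fixed zero-normalized (N,v) and all hyperlink sets H) a payoff vector in ℝ^N such that (i) Σ_{i∈T} f_i(N,v,H)=v(T) for every component T∈N/H, and (ii) Σ_{e∈H_j}(1/|e|)[f_i(N,v,H)−f_i(N,v,H\{e})] = Σ_{e∈H_i}(1/|e|)[f_j(N,v,H)−f_j(N,v,H\{e})] for all i,j∈N and all hyperlink sets H, then f(N,v,H)=π(N,v,H) for every hypergraph game (N,v,H). -/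
open scoped Classical
open Finset

noncomputable section

namespace HGGame

/-! ## Generic hypergraph notions -/

variable {α : Type*}

/-! ## Hypergraph communication situations -/

variable {N : Type*} [Fintype N] [DecidableEq N]

/-! ## Shapley value: efficiency, symmetry, and the dividend formula -/

section Shapley

variable {M : Type*} [Fintype M]

theorem sum_marginal (u : Finset M → ℝ) (σ : M ≃ Fin (Fintype.card M)) :
    ∑ i, marginal u σ i = u univ - u ∅ := by
  set G : ℕ → ℝ := fun k => u (univ.filter fun j => (σ j : ℕ) < k) with hG
  have hmarginal : ∀ i, marginal u σ i = G (σ i + 1) - G (σ i) := by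
    intro i
    have hinsert : insert i (preceding σ i) = univ.filter fun j => (σ j : ℕ) < σ i + 1 := by
      ext j
      simp only [preceding, mem_insert, mem_filter, mem_univ, true_and, Fin.lt_def]
      rw [Nat.lt_succ_iff_lt_or_eq, ← Fin.ext_iff, σ.injective.eq_iff, or_comm]
    have hpreceding : preceding σ i = univ.filter fun j => (σ j : ℕ) < σ i := by
      ext j
      simp only [preceding, Fin.lt_def]
    rw [marginal, hinsert, hpreceding]
  calc ∑ i, marginal u σ i = ∑ i, (G (σ i + 1) - G (σ i)) := sum_congr rfl fun i _ => hmarginal i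
    _ = ∑ k : Fin (Fintype.card M), (G (k + 1) - G k) :=
      σ.sum_comp fun k : Fin (Fintype.card M) => G (k + 1) - G k
    _ = ∑ k ∈ range (Fintype.card M), (G (k + 1) - G k) :=
      Fin.sum_univ_eq_sum_range (fun k => G (k + 1) - G k) _
    _ = u univ - u ∅ := by
      rw [sum_range_sub]
      simp [hG]

theorem factorial_inv_mul_card_orderings :
    ((Fintype.card M).factorial : ℝ)⁻¹ * (Fintype.card (M ≃ Fin (Fintype.card M)) : ℝ) = 1 := by
  rw [Fintype.card_equiv (Fintype.equivFin M)]
  exact inv_mul_cancel₀ (by exact_mod_cast (Nat.factorial_pos _).ne')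

theorem sum_shapley (u : Finset M → ℝ) : ∑ i, shapley u i = u univ - u ∅ := by
  simp only [shapley]
  rw [← mul_sum, sum_comm]
  simp only [sum_marginal, sum_const, card_univ, nsmul_eq_mul]
  rw [← mul_assoc, factorial_inv_mul_card_orderings, one_mul]

theorem shapley_congr [DecidableEq M] {u w : Finset M → ℝ} {i : M}
    (h : ∀ S, u (insert i S) - u S = w (insert i S) - w S) : shapley u i = shapley w i := by
  obtain rfl : ‹DecidableEq M› = fun a b => Classical.propDecidable (a = b) :=
    Subsingleton.elim _ _
  simp only [shapley, marginal, h]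

theorem shapley_eq_zero [DecidableEq M] {u : Finset M → ℝ} {i : M} (h : ∀ S, u (insert i S) = u S) :
    shapley u i = 0 := by
  obtain rfl : ‹DecidableEq M› = fun a b => Classical.propDecidable (a = b) :=
    Subsingleton.elim _ _
  simp [shapley, marginal, h]

theorem shapley_sum {ι : Type*} (s : Finset ι) (c : ι → ℝ) (u : ι → Finset M → ℝ) (i : M) :
    shapley (fun S => ∑ t ∈ s, c t * u t S) i = ∑ t ∈ s, c t * shapley (u t) i := by
  simp only [shapley, marginal, ← sum_sub_distrib, ← mul_sub]
  rw [sum_comm, mul_sum]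
  refine sum_congr rfl fun t _ => ?_
  rw [← mul_sum]
  ring

theorem shapley_swap {u : Finset M → ℝ} {i j : M}
    (h : ∀ S, u (S.map (Equiv.swap i j).toEmbedding) = u S) : shapley u i = shapley u j := by
  unfold shapley
  congr 1
  refine Fintype.sum_equiv (Equiv.equivCongr (Equiv.swap i j) (Equiv.refl _)) _ _ fun σ => ?_
  set τ := Equiv.equivCongr (Equiv.swap i j) (Equiv.refl _) σ
  have hpreceding : preceding τ j = (preceding σ i).map (Equiv.swap i j).toEmbedding := by
    ext k
    simp [τ, preceding, mem_map_equiv]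
  rw [marginal, marginal, hpreceding, h,
    ← h (insert i (preceding σ i)), map_insert]
  simp

/-- The unanimity game of the coalition `T`. -/
def unanimity (T S : Finset M) : ℝ := if T ⊆ S then 1 else 0

theorem shapley_unanimity {T : Finset M} (hT : T.Nonempty) (i : M) :
    shapley (unanimity T) i = if i ∈ T then (T.card : ℝ)⁻¹ else 0 := by
  have houtside : ∀ j ∉ T, shapley (unanimity T) j = 0 := fun j hj =>
    shapley_eq_zero fun S => by simp [unanimity, subset_insert_iff_of_notMem hj]
  split_ifs with hi
  · have hsymm : ∀ j ∈ T, shapley (unanimity T) j = shapley (unanimity T) i := by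
      intro j hj
      refine shapley_swap fun S => ?_
      have hiff : T ⊆ S.map (Equiv.swap j i).toEmbedding ↔ T ⊆ S := by
        have hmem : ∀ k ∈ T, Equiv.swap j i k ∈ T := by
          intro k hk
          rw [Equiv.swap_apply_def]
          split_ifs <;> assumption
        constructor
        · intro h k hk
          simpa [mem_map_equiv] using h (hmem k hk)
        · intro h k hk
          rw [mem_map_equiv, Equiv.symm_swap]
          exact h (hmem k hk)
      simp [unanimity, hiff]
    have hsum := sum_shapley (unanimity T)
    rw [← sum_subset (subset_univ T) fun j _ hj => houtside j hj, sum_congr rfl hsymm] at hsum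
    simp only [sum_const, nsmul_eq_mul, unanimity, subset_univ, subset_empty, hT.ne_empty,
      if_true, if_false, sub_zero] at hsum
    exact eq_inv_of_mul_eq_one_right hsum
  · exact houtside i hi

end Shapley

/-- Every set function is the sum of suitable dividends over subsets. -/
theorem exists_dividends {β : Type*} (W : Finset β → ℝ) :
    ∃ d : Finset β → ℝ, ∀ S, W S = ∑ T ∈ S.powerset, d T := by
  let d : Finset β → ℝ := fun S =>
    Finset.strongInduction (p := fun _ => ℝ)
      (fun S ih => W S - ∑ T ∈ S.ssubsets.attach, ih T.1 (mem_ssubsets.1 T.2)) S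
  refine ⟨d, fun S => ?_⟩
  have hd : d S = W S - ∑ T ∈ S.ssubsets, d T := by
    rw [← sum_attach S.ssubsets]
    exact Finset.strongInduction_eq _ S
  rw [← sum_erase_add _ _ (mem_powerset_self S)]
  rw [hd, ssubsets]
  ring

theorem shapley_of_dividends {β : Type*} [DecidableEq β] (H : Finset β) (d : Finset β → ℝ) (hd : d ∅ = 0)
    (e : {e // e ∈ H}) :
    shapley (fun F : Finset {e // e ∈ H} => ∑ T ∈ (F.image Subtype.val).powerset, d T) e
      = ∑ T ∈ H.powerset.filter (fun T => e.1 ∈ T), d T * (T.card : ℝ)⁻¹ := by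
  have hgame : (fun F : Finset {e // e ∈ H} => ∑ T ∈ (F.image Subtype.val).powerset, d T)
      = fun F => ∑ T ∈ H.powerset, d T * unanimity (T.subtype (· ∈ H)) F := by
    funext F
    have hF : F.image Subtype.val ⊆ H := by
      intro x hx
      obtain ⟨y, -, rfl⟩ := mem_image.1 hx
      exact y.2
    rw [← sum_subset (powerset_mono.2 hF)]
    · refine sum_congr rfl fun T hT => ?_
      have hsub : T.subtype (· ∈ H) ⊆ F := by
        intro x hx
        simpa using mem_powerset.1 hT (mem_subtype.1 hx)
      simp [unanimity, hsub]
    · intro T hT hTF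
      have hsub : ¬ T.subtype (· ∈ H) ⊆ F := by
        intro h
        refine hTF (mem_powerset.2 fun x hx => ?_)
        have hxH := mem_powerset.1 hT hx
        exact mem_image.2 ⟨⟨x, hxH⟩, h (mem_subtype.2 hx), rfl⟩
      simp [unanimity, hsub]
  rw [hgame, shapley_sum, sum_filter]
  refine sum_congr rfl fun T hT => ?_
  rcases T.eq_empty_or_nonempty with rfl | ⟨x, hx⟩
  · simp [hd]
  · have hTH := mem_powerset.1 hT
    have hne : (T.subtype (· ∈ H)).Nonempty := ⟨⟨x, hTH hx⟩, mem_subtype.2 hx⟩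
    rw [shapley_unanimity hne, card_subtype, filter_true_of_mem fun y hy => hTH hy]
    simp

/-! ## Components of a hypergraph -/

section Components

variable {β : Type*}

theorem Linked.symm {E : Finset (Finset β)} {i j : β} (h : Linked E i j) : Linked E j i := by
  obtain ⟨e, he, hi, hj⟩ := h
  exact ⟨e, he, hj, hi⟩

theorem reflTransGen_linked_mono {E E' : Finset (Finset β)} (hE : E ⊆ E') {i j : β}
    (h : Relation.ReflTransGen (Linked E) i j) : Relation.ReflTransGen (Linked E') i j :=
  h.lift id fun _ _ ⟨e, he, hab⟩ => ⟨e, hE he, hab⟩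

variable [Fintype β]

theorem mem_components {E : Finset (Finset β)} {T : Finset β} :
    T ∈ components E univ ↔ ∃ i, compOf E univ i = T := by
  simp [components]

theorem compOf_mem_components (E : Finset (Finset β)) (i : β) :
    compOf E univ i ∈ components E univ :=
  mem_components.2 ⟨i, rfl⟩

theorem mem_compOf_univ {E : Finset (Finset β)} {i j : β} :
    j ∈ compOf E univ i ↔ Relation.ReflTransGen (Linked E) i j := by
  simp [compOf]

theorem compOf_eq_of_mem {E : Finset (Finset β)} {i j : β} (h : j ∈ compOf E univ i) :
    compOf E univ j = compOf E univ i := by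
  have hij := mem_compOf_univ.1 h
  have : Std.Symm (Linked E) := ⟨fun _ _ => Linked.symm⟩
  have hji : Relation.ReflTransGen (Linked E) j i :=
    Relation.ReflTransGen.stdSymm.symm _ _ hij
  ext k
  rw [mem_compOf_univ, mem_compOf_univ]
  exact ⟨hij.trans, hji.trans⟩

theorem self_mem_compOf (E : Finset (Finset β)) (i : β) : i ∈ compOf E univ i :=
  mem_compOf_univ.2 .refl

theorem restrictedWorth_eq_sum (v : Finset β → ℝ) (E : Finset (Finset β)) :
    restrictedWorth v E univ
      = ∑ i, v (compOf E univ i) * ((compOf E univ i).card : ℝ)⁻¹ := by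
  rw [restrictedWorth, ← sum_fiberwise_of_maps_to (g := compOf E univ) (t := components E univ)
    fun i _ => compOf_mem_components E i]
  refine sum_congr rfl fun T hT => ?_
  obtain ⟨i, rfl⟩ := mem_components.1 hT
  have hfiber : univ.filter (fun j => compOf E univ j = compOf E univ i) = compOf E univ i := by
    ext j
    simp only [mem_filter, mem_univ, true_and]
    exact ⟨fun h => h ▸ self_mem_compOf E j, compOf_eq_of_mem⟩
  rw [sum_congr rfl fun j hj => by rw [(mem_filter.1 hj).2], sum_const, hfiber, nsmul_eq_mul]
  have hcard : ((compOf E univ i).card : ℝ) ≠ 0 := by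
    exact_mod_cast (card_pos.2 ⟨i, self_mem_compOf E i⟩).ne'
  field_simp

/-- A hyperlink disjoint from the component of `i` in a larger hypergraph does not affect the
component of `i`. -/
theorem compOf_insert [DecidableEq β] {H F : Finset (Finset β)} (hF : F ⊆ H) {e : Finset β} {i : β}
    (he : Disjoint e (compOf H univ i)) : compOf (insert e F) univ i = compOf F univ i := by
  ext j
  rw [mem_compOf_univ, mem_compOf_univ]
  constructor
  · intro h
    induction h with
    | refl => exact .refl
    | @tail b c _ hbc ih =>
      obtain ⟨e', he', hb, hc⟩ := hbc
      rcases mem_insert.1 he' with rfl | he'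
      · refine absurd (mem_compOf_univ.2 ?_) (disjoint_left.1 he hb)
        exact reflTransGen_linked_mono hF ih
      · exact ih.tail ⟨e', he', hb, hc⟩
  · exact reflTransGen_linked_mono (subset_insert e F)

theorem subset_compOf {H : Finset (Finset β)} {e : Finset β} (he : e ∈ H) {i j : β}
    (hj : j ∈ e) (hji : j ∈ compOf H univ i) : e ⊆ compOf H univ i := fun _ hk =>
  mem_compOf_univ.2 ((mem_compOf_univ.1 hji).tail ⟨e, he, hj, hk⟩)

theorem compOf_empty (i : β) : compOf ∅ univ i = {i} := by
  ext j
  simp only [compOf, filter_empty, mem_filter, mem_univ, true_and, mem_singleton]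
  constructor
  · intro h
    induction h with
    | refl => rfl
    | tail _ h _ => simp [Linked] at h
  · rintro rfl
    exact .refl

theorem restrictedWorth_empty (v : Finset β → ℝ) (hzn : ∀ i : β, v {i} = 0) :
    restrictedWorth v ∅ univ = 0 := by
  refine sum_eq_zero fun T hT => ?_
  obtain ⟨i, rfl⟩ := mem_components.1 hT
  rw [compOf_empty, hzn]

end Components

/-! ## Partial balanced conference contributions of the position value -/

theorem positionValue_eq_sum_dividends (v : Finset N → ℝ) (hzn : ∀ i : N, v {i} = 0) :
    ∃ d : Finset (Finset N) → ℝ, ∀ H i, positionValue v H i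
      = ∑ e ∈ H.filter (fun e => i ∈ e), (e.card : ℝ)⁻¹ *
          ∑ T ∈ H.powerset.filter (fun T => e ∈ T), d T * (T.card : ℝ)⁻¹ := by
  obtain ⟨d, hd⟩ := exists_dividends fun E : Finset (Finset N) => restrictedWorth v E univ
  have hd0 : d ∅ = 0 := by
    simpa [restrictedWorth_empty v hzn] using (hd ∅).symm
  refine ⟨d, fun H i => ?_⟩
  have hgame : confGame v H = fun F => ∑ T ∈ (F.image Subtype.val).powerset, d T := by
    funext F
    exact hd _
  rw [positionValue, hgame, sum_filter, sum_filter, ← sum_attach H]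
  refine sum_congr rfl fun e _ => ?_
  rw [shapley_of_dividends H d hd0]

theorem positionValue_balanced (v : Finset N → ℝ) (hzn : ∀ i : N, v {i} = 0)
    (H : Finset (Finset N)) (i j : N) :
    ∑ e ∈ H.filter (fun e => j ∈ e),
        (e.card : ℝ)⁻¹ * (positionValue v H i - positionValue v (H.erase e) i)
      = ∑ e ∈ H.filter (fun e => i ∈ e),
        (e.card : ℝ)⁻¹ * (positionValue v H j - positionValue v (H.erase e) j) := by
  obtain ⟨d, hd⟩ := positionValue_eq_sum_dividends v hzn
  have hdiff : ∀ (e : Finset N) (k : N), positionValue v H k - positionValue v (H.erase e) k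
      = ∑ e' ∈ H.filter (fun e' => k ∈ e'), (e'.card : ℝ)⁻¹ *
          ∑ T ∈ H.powerset.filter (fun T => e ∈ T ∧ e' ∈ T), d T * (T.card : ℝ)⁻¹ := by
    intro e k
    have hextend : positionValue v (H.erase e) k
        = ∑ e' ∈ H.filter (fun e' => k ∈ e'), (e'.card : ℝ)⁻¹ *
            ∑ T ∈ H.powerset.filter (fun T => e ∉ T ∧ e' ∈ T), d T * (T.card : ℝ)⁻¹ := by
      have hsets : ∀ e', (H.erase e).powerset.filter (fun T => e' ∈ T)
          = H.powerset.filter (fun T => e ∉ T ∧ e' ∈ T) := by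
        intro e'
        ext T
        simp [subset_erase, and_assoc]
      rw [hd]
      simp only [hsets]
      refine sum_subset (filter_subset_filter _ (erase_subset _ _)) fun e' he' hne => ?_
      have heq : e' = e := by
        by_contra h
        exact hne (by simpa [h] using he')
      subst heq
      rw [filter_false_of_mem fun T _ h => h.1 h.2]
      simp
    rw [hextend, hd, ← sum_sub_distrib]
    refine sum_congr rfl fun e' _ => ?_
    rw [← mul_sub]
    congr 1
    rw [sub_eq_iff_eq_add]
    rw [← sum_filter_add_sum_filter_not (H.powerset.filter fun T => e' ∈ T) (fun T => e ∈ T)]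
    simp only [filter_filter, and_comm]
  simp only [hdiff, mul_sum]
  rw [sum_comm]
  refine sum_congr rfl fun e _ => sum_congr rfl fun e' _ => ?_
  simp only [and_comm, mul_left_comm]

/-! ## Component efficiency of the position value -/

theorem positionValue_efficient (v : Finset N → ℝ) (hzn : ∀ i : N, v {i} = 0)
    (H : Finset (Finset N)) (hH : ∀ e ∈ H, 1 < e.card) (r : N) :
    ∑ i ∈ compOf H univ r, positionValue v H i = v (compOf H univ r) := by
  set C := compOf H univ r with hC
  set share : Finset {e // e ∈ H} → N → ℝ := fun F i =>
    v (compOf (F.image Subtype.val) univ i) *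
      ((compOf (F.image Subtype.val) univ i).card : ℝ)⁻¹ with hshare
  have himage : ∀ F : Finset {e // e ∈ H}, F.image Subtype.val ⊆ H := by
    intro F x hx
    obtain ⟨y, -, rfl⟩ := mem_image.1 hx
    exact y.2
  have hinsert : ∀ (e : {e // e ∈ H}) (F : Finset {e // e ∈ H}) (i : N),
      Disjoint e.1 (compOf H univ i) → share (insert e F) i = share F i := by
    intro e F i hd
    simp only [hshare, image_insert, compOf_insert (himage F) hd]
  have hpayoff : ∀ e : {e // e ∈ H},
      (∑ i ∈ C, if i ∈ e.1 then (e.1.card : ℝ)⁻¹ * shapley (confGame v H) e else 0)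
        = shapley (fun F => ∑ i ∈ C, share F i) e := by
    intro e
    by_cases hdisj : Disjoint e.1 C
    · have hzero : shapley (fun F => ∑ i ∈ C, share F i) e = 0 := by
        refine shapley_eq_zero fun F => sum_congr rfl fun i hi => hinsert e F i ?_
        rwa [compOf_eq_of_mem hi]
      rw [hzero]
      exact sum_eq_zero fun i hi => if_neg fun h => disjoint_left.1 hdisj h hi
    · obtain ⟨j, hje, hjC⟩ := not_disjoint_iff.1 hdisj
      have hsub : e.1 ⊆ C := subset_compOf e.2 hje hjC
      rw [← sum_filter, filter_mem_eq_inter, inter_eq_right.2 hsub, sum_const, nsmul_eq_mul,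
        ← mul_assoc, mul_inv_cancel₀, one_mul]
      · refine shapley_congr fun F => ?_
        have hsplit : ∀ F, confGame v H F = ∑ i ∈ C, share F i + ∑ i ∈ Cᶜ, share F i := by
          intro F
          rw [sum_add_sum_compl]
          exact restrictedWorth_eq_sum v _
        have hcompl : ∑ i ∈ Cᶜ, share (insert e F) i = ∑ i ∈ Cᶜ, share F i := by
          refine sum_congr rfl fun i hi => hinsert e F i ?_
          refine disjoint_left.2 fun k hk hki => mem_compl.1 hi ?_
          rw [hC, ← compOf_eq_of_mem (hsub hk), compOf_eq_of_mem hki]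
          exact self_mem_compOf H i
        rw [hsplit, hsplit, hcompl]
        ring
      · exact_mod_cast (Nat.zero_lt_of_lt (hH e.1 e.2)).ne'
  have htotal : ∑ i ∈ C, positionValue v H i
      = ∑ e : {e // e ∈ H}, shapley (fun F => ∑ i ∈ C, share F i) e := by
    simp only [positionValue, sum_filter]
    rw [sum_comm]
    exact sum_congr rfl fun e _ => hpayoff e
  have hempty : ∑ i ∈ C, share ∅ i = 0 := by
    simp [hshare, compOf_empty, hzn]
  have hfull : ∑ i ∈ C, share univ i = v C := by
    have himage_univ : (univ : Finset {e // e ∈ H}).image Subtype.val = H := by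
      ext; simp
    have hcard : (C.card : ℝ) ≠ 0 := by
      exact_mod_cast (card_pos.2 ⟨r, self_mem_compOf H r⟩).ne'
    rw [sum_congr rfl fun i hi => by
      simp only [hshare, himage_univ]; rw [compOf_eq_of_mem hi], sum_const, nsmul_eq_mul, ← hC]
    field_simp
  rw [htotal, sum_shapley, hempty, hfull, sub_zero]

/-! ## Uniqueness -/

/-- Theorem 3 (uniqueness part): any allocation rule satisfying component efficiency
and partial balanced conference contributions coincides with the position value. -/
theorem position_value_unique
    {N : Type*} [Fintype N] [DecidableEq N]
    (v : Finset N → ℝ)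
    (hN : 2 ≤ Fintype.card N)
    (hv0 : v ∅ = 0) (hzn : ∀ i : N, v {i} = 0)
    (f : Finset (Finset N) → N → ℝ)
    (hCE : ∀ H : Finset (Finset N), (∀ e ∈ H, 1 < e.card) →
      ∀ T ∈ components H Finset.univ, ∑ i ∈ T, f H i = v T)
    (hPBC : ∀ H : Finset (Finset N), (∀ e ∈ H, 1 < e.card) → ∀ i j : N,
      ∑ e ∈ H.filter (fun e => j ∈ e), (e.card : ℝ)⁻¹ * (f H i - f (H.erase e) i)
        = ∑ e ∈ H.filter (fun e => i ∈ e), (e.card : ℝ)⁻¹ * (f H j - f (H.erase e) j)) :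
    ∀ H : Finset (Finset N), (∀ e ∈ H, 1 < e.card) →
      ∀ i : N, f H i = positionValue v H i := by
  intro H
  induction H using Finset.strongInduction with
  | H H ih =>
    intro hH
    have herase : ∀ e ∈ H, ∀ k, f (H.erase e) k = positionValue v (H.erase e) k := fun e he =>
      ih _ (erase_ssubset he) fun e' he' => hH e' (mem_of_mem_erase he')
    set a : N → ℝ := fun k => ∑ e ∈ H.filter (fun e => k ∈ e), (e.card : ℝ)⁻¹ with ha
    set δ : N → ℝ := fun k => f H k - positionValue v H k with hδ
    have hprop : ∀ i j, a j * δ i = a i * δ j := by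
      have hdiff : ∀ i j, ∑ e ∈ H.filter (fun e => j ∈ e),
            (e.card : ℝ)⁻¹ * (f H i - f (H.erase e) i)
          - ∑ e ∈ H.filter (fun e => j ∈ e),
            (e.card : ℝ)⁻¹ * (positionValue v H i - positionValue v (H.erase e) i)
          = a j * δ i := by
        intro i j
        rw [← sum_sub_distrib, ha, sum_mul]
        refine sum_congr rfl fun e he => ?_
        rw [herase e (mem_filter.1 he).1, hδ]
        ring
      intro i j
      rw [← hdiff i j, ← hdiff j i, hPBC H hH i j, positionValue_balanced v hzn H i j]
    intro i
    have hsum : ∑ j ∈ compOf H univ i, δ j = 0 := by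
      rw [hδ, sum_sub_distrib, positionValue_efficient v hzn H hH i,
        hCE H hH _ (compOf_mem_components H i), sub_self]
    refine sub_eq_zero.1 (show δ i = 0 from ?_)
    by_cases hi : ∃ e ∈ H, i ∈ e
    · obtain ⟨e, he, hie⟩ := hi
      have hnonneg : ∀ k, 0 ≤ a k := fun k => sum_nonneg fun _ _ => by positivity
      have hpos : 0 < a i := by
        refine sum_pos (fun e he => ?_) ⟨e, mem_filter.2 ⟨he, hie⟩⟩
        have hcard := hH e (mem_filter.1 he).1
        positivity
      have hzero : (∑ j ∈ compOf H univ i, a j) * δ i = 0 := by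
        rw [sum_mul, sum_congr rfl fun j _ => hprop i j, ← mul_sum, hsum, mul_zero]
      refine (mul_eq_zero.1 hzero).resolve_left (ne_of_gt ?_)
      exact sum_pos' (fun j _ => hnonneg j) ⟨i, self_mem_compOf H i, hpos⟩
    · have hcomp : compOf H univ i = {i} := by
        ext j
        rw [mem_compOf_univ, mem_singleton]
        constructor
        · intro h
          rcases h.cases_head with h | ⟨k, ⟨e, he, hie, -⟩, -⟩
          · exact h.symm
          · exact absurd ⟨e, he, hie⟩ hi
        · rintro rfl
          exact .refl
      simpa [hcomp] using hsum

end HGGame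
end
end

section
/- If (N,v,H) is a hypergraph communication situation in which the hypergraph (N,H) is r-uniform (i.e., |e|=r for all e∈H), then the position value satisfies balanced conference contributions: for all i,j∈N, Σ_{e∈H_j}[π_i(N,v,H)−π_i(N,v,H\{e})] = Σ_{e∈H_i}[π_j(N,v,H)−π_j(N,v,H\{e})]. -/
open scoped Classical
open Finset

noncomputable section

namespace HGGame

/-! ## Generic hypergraph notions -/

variable {α : Type*}

/-! ## Hypergraph communication situations -/

variable {N : Type*} [Fintype N] [DecidableEq N]

/-! ## Harsanyi dividends and the Shapley value -/

/-- The dividends of `u` (including the one of the empty coalition), defined recursively by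
`u S = ∑ T ⊆ S, mobius u T`. -/
def mobius {β : Type*} (u : Finset β → ℝ) (S : Finset β) : ℝ :=
  u S - ∑ T ∈ S.ssubsets.attach, mobius u T.1
termination_by S.card
decreasing_by exact Finset.card_lt_card (Finset.mem_ssubsets.1 T.2)

lemma sum_powerset_mobius {β : Type*} (u : Finset β → ℝ) (S : Finset β) :
    ∑ T ∈ S.powerset, mobius u T = u S := by
  rw [← Finset.add_sum_erase _ _ (Finset.mem_powerset_self S), mobius,
    Finset.sum_attach S.ssubsets (mobius u), Finset.ssubsets]
  ring

section Shapley

variable {M : Type*} [Fintype M]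

/-- The number of orderings in which `e` comes last within `T`. -/
def lastCount (T : Finset M) (e : M) : ℝ :=
  ∑ σ : M ≃ Fin (Fintype.card M), if ∀ t ∈ T, σ t ≤ σ e then 1 else 0

lemma lastCount_eq {T : Finset M} {e f : M} (he : e ∈ T) (hf : f ∈ T) :
    lastCount T e = lastCount T f := by
  unfold lastCount
  refine Fintype.sum_equiv (Equiv.equivCongr (Equiv.swap e f) (Equiv.refl _)) _ _ fun σ => ?_
  have key : (∀ t ∈ T, σ t ≤ σ e) ↔
      ∀ t ∈ T, (Equiv.equivCongr (Equiv.swap e f) (Equiv.refl _) σ) t ≤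
        (Equiv.equivCongr (Equiv.swap e f) (Equiv.refl _) σ) f := by
    have hs : ∀ t ∈ T, Equiv.swap e f t ∈ T := by
      intro t ht
      rw [Equiv.swap_apply_def]
      split_ifs <;> assumption
    simp only [Equiv.equivCongr_apply_apply, Equiv.symm_swap, Equiv.swap_apply_right,
      Equiv.refl_apply]
    refine ⟨fun h t ht => h _ (hs t ht), fun h t ht => ?_⟩
    simpa using h _ (hs t ht)
  simp only [key]

lemma sum_lastCount {T : Finset M} (hT : T.Nonempty) :
    ∑ e ∈ T, lastCount T e = ((Fintype.card M).factorial : ℝ) := by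
  unfold lastCount
  rw [Finset.sum_comm]
  have one : ∀ σ : M ≃ Fin (Fintype.card M),
      (∑ e ∈ T, if ∀ t ∈ T, σ t ≤ σ e then (1 : ℝ) else 0) = 1 := by
    intro σ
    obtain ⟨m, hm, hmax⟩ := Finset.exists_max_image T σ hT
    rw [Finset.sum_eq_single_of_mem m hm, if_pos hmax]
    intro b hb hne
    refine if_neg fun h => hne ?_
    exact σ.injective (le_antisymm (hmax b hb) (h m hm))
  simp only [one]
  simp [Fintype.card_equiv (Fintype.equivFin M)]

lemma lastCount_eq_div {T : Finset M} {e : M} (he : e ∈ T) :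
    lastCount T e = ((Fintype.card M).factorial : ℝ) / T.card := by
  have hT : T.Nonempty := ⟨e, he⟩
  have h := sum_lastCount hT
  rw [Finset.sum_congr rfl fun f hf => lastCount_eq hf he, Finset.sum_const, nsmul_eq_mul] at h
  have : (T.card : ℝ) ≠ 0 := by exact_mod_cast hT.card_pos.ne'
  rw [eq_div_iff this, mul_comm, h]

lemma marginal_unanimity (T : Finset M) (σ : M ≃ Fin (Fintype.card M)) (e : M) :
    marginal (fun S => if T ⊆ S then 1 else 0) σ e =
      if e ∈ T then (if ∀ t ∈ T, σ t ≤ σ e then 1 else 0) else 0 := by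
  have hne : e ∉ preceding σ e := by simp [preceding]
  unfold marginal
  by_cases he : e ∈ T
  · have h1 : ¬ T ⊆ preceding σ e := fun h => hne (h he)
    have h2 : T ⊆ insert e (preceding σ e) ↔ ∀ t ∈ T, σ t ≤ σ e := by
      refine forall₂_congr fun t _ => ?_
      simp [preceding, le_iff_eq_or_lt]
    simp [he, h1, h2]
  · simp [he, Finset.subset_insert_iff_of_notMem he]

lemma marginal_sum (l : Finset M → ℝ) (σ : M ≃ Fin (Fintype.card M)) (e : M) :
    marginal (fun S => ∑ T ∈ S.powerset, l T) σ e =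
      ∑ T : Finset M, l T * marginal (fun S => if T ⊆ S then 1 else 0) σ e := by
  have h : ∀ S : Finset M, ∑ T ∈ S.powerset, l T =
      ∑ T : Finset M, l T * if T ⊆ S then 1 else 0 := by
    intro S
    simp only [mul_ite, mul_one, mul_zero, ← Finset.sum_filter]
    refine Finset.sum_congr ?_ fun _ _ => rfl
    ext T
    simp
  simp only [marginal, h, ← Finset.sum_sub_distrib, mul_sub]

/-- The Shapley value distributes each dividend equally among the members of its coalition. -/
lemma shapley_sum_powerset (l : Finset M → ℝ) (e : M) :
    shapley (fun S => ∑ T ∈ S.powerset, l T) e =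
      ∑ T : Finset M, if e ∈ T then l T / T.card else 0 := by
  unfold shapley
  simp only [marginal_sum]
  rw [Finset.sum_comm, Finset.mul_sum]
  refine Finset.sum_congr rfl fun T _ => ?_
  rw [← Finset.mul_sum]
  simp only [marginal_unanimity]
  split_ifs with he
  · have h := lastCount_eq_div he
    unfold lastCount at h
    rw [h]
    have : ((Fintype.card M).factorial : ℝ) ≠ 0 := by exact_mod_cast Nat.factorial_ne_zero _
    field_simp
  · simp

end Shapley

/-! ## Balanced contributions -/

/-- The share of `e` in the dividends of the coalitions of hyperlinks in `H`. -/
def dividendShare {β : Type*} [DecidableEq β] (l : Finset β → ℝ) (H : Finset β)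
    (e : β) : ℝ :=
  ∑ T ∈ H.powerset, if e ∈ T then l T / T.card else 0

lemma sum_powerset_image_val {β : Type*} [DecidableEq β] {H : Finset β} (g : Finset β → ℝ)
    (F : Finset {e // e ∈ H}) :
    ∑ T ∈ (F.image Subtype.val).powerset, g T =
      ∑ T ∈ F.powerset, g (T.image Subtype.val) := by
  rw [Finset.powerset_image, Finset.sum_image]
  exact (Finset.image_injective Subtype.val_injective).injOn

lemma shapley_confGame {N : Type*} [Fintype N] [DecidableEq N] (v : Finset N → ℝ)
    (H : Finset (Finset N)) (e : {e // e ∈ H}) :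
    shapley (confGame v H) e =
      dividendShare (mobius fun E => restrictedWorth v E Finset.univ) H e.1 := by
  set l := mobius fun E => restrictedWorth v E (Finset.univ : Finset N) with hl
  have h : confGame v H = fun F => ∑ T ∈ F.powerset, l (T.image Subtype.val) := by
    funext F
    rw [← sum_powerset_image_val, hl, sum_powerset_mobius]
    rfl
  rw [h, shapley_sum_powerset, dividendShare]
  have hH : H.powerset = ((Finset.univ : Finset {e // e ∈ H}).image Subtype.val).powerset := by
    congr 1
    ext a
    simp
  rw [hH, sum_powerset_image_val (fun T => if e.1 ∈ T then l T / T.card else 0),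
    Finset.powerset_univ]
  refine Finset.sum_congr rfl fun T _ => ?_
  rw [Finset.card_image_of_injective _ Subtype.val_injective]
  simp

lemma dividendShare_sub_erase {β : Type*} [DecidableEq β] (l : Finset β → ℝ) (H : Finset β)
    (e f : β) :
    dividendShare l H e - dividendShare l (H.erase f) e =
      ∑ T ∈ H.powerset, if e ∈ T ∧ f ∈ T then l T / T.card else 0 := by
  have h : dividendShare l (H.erase f) e =
      ∑ T ∈ H.powerset, if f ∈ T then 0 else if e ∈ T then l T / T.card else 0 := by
    rw [← Finset.sum_filter_add_sum_filter_not _ (fun T => f ∈ T),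
      Finset.sum_eq_zero, zero_add, dividendShare]
    · refine Finset.sum_congr ?_ fun T hT => ?_
      · ext T
        simp [Finset.subset_erase]
      · rw [if_neg (Finset.mem_filter.1 hT).2]
    · intro T hT
      rw [if_pos (Finset.mem_filter.1 hT).2]
  rw [h, dividendShare, ← Finset.sum_sub_distrib]
  refine Finset.sum_congr rfl fun T _ => ?_
  by_cases he : e ∈ T <;> by_cases hf : f ∈ T <;> simp [he, hf]

lemma positionValue_eq {N : Type*} [Fintype N] [DecidableEq N] (v : Finset N → ℝ)
    {H K : Finset (Finset N)} (hK : K ⊆ H) {r : ℕ} (hr : ∀ e ∈ H, e.card = r) (i : N) :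
    positionValue v K i = ∑ e ∈ H.filter (fun e => i ∈ e), (r : ℝ)⁻¹ *
      dividendShare (mobius fun E => restrictedWorth v E Finset.univ) K e := by
  set l := mobius fun E => restrictedWorth v E (Finset.univ : Finset N)
  have h : positionValue v K i =
      ∑ e ∈ K.filter (fun e => i ∈ e), (r : ℝ)⁻¹ * dividendShare l K e := by
    unfold positionValue
    rw [Finset.sum_filter, Finset.sum_filter, ← Finset.sum_attach K]
    refine Finset.sum_congr rfl fun e _ => ?_
    rw [shapley_confGame, hr _ (hK e.2)]
  rw [h]
  refine Finset.sum_subset (Finset.filter_subset_filter _ hK) fun e he hne => ?_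
  have heK : e ∉ K := fun h => hne (Finset.mem_filter.2 ⟨h, (Finset.mem_filter.1 he).2⟩)
  rw [dividendShare, Finset.sum_eq_zero, mul_zero]
  exact fun T hT => if_neg fun h => heK (Finset.mem_powerset.1 hT h)

lemma sum_positionValue_sub_erase {N : Type*} [Fintype N] [DecidableEq N] (v : Finset N → ℝ)
    {H : Finset (Finset N)} {r : ℕ} (hr : ∀ e ∈ H, e.card = r) (i j : N) :
    ∑ f ∈ H.filter (fun f => j ∈ f), (positionValue v H i - positionValue v (H.erase f) i) =
      ∑ f ∈ H.filter (fun f => j ∈ f), ∑ e ∈ H.filter (fun e => i ∈ e), (r : ℝ)⁻¹ *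
        ∑ T ∈ H.powerset, if e ∈ T ∧ f ∈ T then
          mobius (fun E => restrictedWorth v E Finset.univ) T / T.card else 0 := by
  refine Finset.sum_congr rfl fun f _ => ?_
  rw [positionValue_eq v subset_rfl hr, positionValue_eq v (Finset.erase_subset f H) hr,
    ← Finset.sum_sub_distrib]
  refine Finset.sum_congr rfl fun e _ => ?_
  rw [← mul_sub, dividendShare_sub_erase]

/-- On `r`-uniform hypergraphs the position value satisfies balanced conference
contributions. -/
theorem position_value_balanced_conference_contributions_of_uniform
    {N : Type*} [Fintype N] [DecidableEq N]
    (v : Finset N → ℝ) (H : Finset (Finset N))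
    (hN : 2 ≤ Fintype.card N)
    (hv0 : v ∅ = 0) (hzn : ∀ i : N, v {i} = 0)
    (hH : ∀ e ∈ H, 1 < e.card)
    (r : ℕ) (hr : ∀ e ∈ H, e.card = r) (i j : N) :
    ∑ e ∈ H.filter (fun e => j ∈ e),
        (positionValue v H i - positionValue v (H.erase e) i)
      = ∑ e ∈ H.filter (fun e => i ∈ e),
        (positionValue v H j - positionValue v (H.erase e) j) := by
  rw [sum_positionValue_sub_erase v hr i j, sum_positionValue_sub_erase v hr j i,
    Finset.sum_comm]
  simp only [and_comm]

end HGGame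
end
end

section
/- Let (N,v,H) be a hypergraph communication situation, let e∈H with η(H\{e})=η(H), and let l'∈U(H)(e). Then every player l in Ū(H,l') = (U(H)\{l'}) \ U(H\{e}) is a null player of the subgame (U(H)\{l'}, w_{U(H)\{l'}}) (i.e., w(K∪{l})=w(K) for all K⊆U(H)\{l',l}); consequently Sh_l(U(H)\{l'}, w_{U(H)\{l'}})=0 for every l∈Ū(H,l'), and Sh_l(U(H)\{l'}, w_{U(H)\{l'}}) = Sh_l(U(H\{e}), w_{U(H\{e})}) for every l∈U(H\{e}), where (U(H\{e}), w_{U(H\{e})}) is the uniform hyperlink game of (N,v,H\{e}) and w_{U(H)\{l'}} is the restriction of w to subsets of U(H)\{l'}. -/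
open scoped Classical
open Finset

noncomputable section

namespace HGGame

/-! ## Generic hypergraph notions -/

variable {α : Type*}

/-! ## Hypergraph communication situations -/

variable {N : Type*} [Fintype N] [DecidableEq N]

/-- The ordering of `M'` induced by an ordering of `M` along an injection `M' ↪ M`. -/
theorem exists_induced_ordering {M M' : Type*} [Fintype M] [Fintype M'] (s : M' ↪ M)
    (σ : M ≃ Fin (Fintype.card M)) :
    ∃ ρ : M' ≃ Fin (Fintype.card M'), ∀ a b, ρ a < ρ b ↔ σ (s a) < σ (s b) := by
  let _ : LinearOrder M' := LinearOrder.lift' (fun a => σ (s a)) (σ.injective.comp s.injective)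
  refine ⟨(Fintype.orderIsoFinOfCardEq M' rfl).symm.toEquiv, fun a b => ?_⟩
  exact (Fintype.orderIsoFinOfCardEq M' rfl).symm.lt_iff_lt

/-- Null player out: if the worth of a coalition of `M` depends only on its trace on `M'`,
then the players of `M'` have the same Shapley value in both games. -/
theorem shapley_eq_of_carrier {M M' : Type*} [Fintype M] [Fintype M'] (s : M' ↪ M)
    (u : Finset M → ℝ) (u' : Finset M' → ℝ)
    (h : ∀ F F', (∀ a, a ∈ F' ↔ s a ∈ F) → u F = u' F') (i : M') :
    shapley u (s i) = shapley u' i := by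
  have hfix : ∀ σ : M ≃ Fin (Fintype.card M),
      ∑ τ : Equiv.Perm M', marginal u ((τ.viaEmbedding s).trans σ) (s i)
        = ∑ ρ : M' ≃ Fin (Fintype.card M'), marginal u' ρ i := by
    intro σ
    obtain ⟨ρ, hρ⟩ := exists_induced_ordering s σ
    refine Fintype.sum_equiv (Equiv.equivCongr (Equiv.refl M') ρ) _ _ fun τ => ?_
    refine congrArg₂ _ (h _ _ fun a => ?_) (h _ _ fun a => ?_) <;>
      simp [preceding, Equiv.equivCongr, Equiv.Perm.viaEmbedding_apply, hρ]
  have hmove : ∀ τ : Equiv.Perm M',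
      ∑ σ : M ≃ Fin (Fintype.card M), marginal u ((τ.viaEmbedding s).trans σ) (s i)
        = ∑ σ : M ≃ Fin (Fintype.card M), marginal u σ (s i) := fun τ =>
    Fintype.sum_equiv (Equiv.equivCongr (τ.viaEmbedding s).symm (Equiv.refl _)) _ _ fun σ => by
      rfl
  have hsum : ((Fintype.card M').factorial : ℝ)
        * ∑ σ : M ≃ Fin (Fintype.card M), marginal u σ (s i)
      = ((Fintype.card M).factorial : ℝ)
        * ∑ ρ : M' ≃ Fin (Fintype.card M'), marginal u' ρ i := by
    have hswap := Finset.sum_comm (s := (Finset.univ : Finset (Equiv.Perm M')))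
      (t := (Finset.univ : Finset (M ≃ Fin (Fintype.card M))))
      (f := fun τ σ => marginal u ((τ.viaEmbedding s).trans σ) (s i))
    simp only [hfix, hmove, Finset.sum_const, Finset.card_univ, nsmul_eq_mul,
      Fintype.card_perm, Fintype.card_equiv (Fintype.equivFin M)] at hswap
    exact hswap
  unfold shapley
  have h1 : ((Fintype.card M).factorial : ℝ) ≠ 0 := by positivity
  have h2 : ((Fintype.card M').factorial : ℝ) ≠ 0 := by positivity
  field_simp
  linarith

/-- A null player has zero Shapley value. -/
theorem shapley_eq_zero_of_null {M : Type*} [Fintype M] (u : Finset M → ℝ) (i : M)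
    (h : ∀ F, i ∉ F → u (insert i F) = u F) : shapley u i = 0 := by
  unfold shapley marginal
  rw [Finset.sum_eq_zero, mul_zero]
  intro σ _
  rw [h _ (by simp [preceding]), sub_self]

theorem UHe_subset_UH {H : Finset (Finset N)} {f : Finset N} (hf : f ∈ H) :
    UHe H f ⊆ UH H := by
  intro x hx
  simp only [UHe, UH, UHi, Finset.mem_biUnion, Finset.mem_filter, Finset.mem_univ,
    true_and] at hx ⊢
  obtain ⟨i, hi, hx⟩ := hx
  exact ⟨i, f, ⟨hf, hi⟩, hx⟩

theorem UHe_congr {N : Type*} [DecidableEq N] {H H' : Finset (Finset N)} (h : eta H = eta H') (f : Finset N) :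
    UHe H f = UHe H' f := by
  simp only [UHe, UHie, h]

theorem UH_erase_subset {H : Finset (Finset N)} {e : Finset N}
    (heta : eta (H.erase e) = eta H) : UH (H.erase e) ⊆ UH H := by
  intro x hx
  simp only [UH, UHi, UHie, heta, Finset.mem_biUnion, Finset.mem_filter, Finset.mem_univ,
    Finset.mem_erase, true_and] at hx ⊢
  obtain ⟨i, f, ⟨⟨-, hf⟩, hi⟩, hx⟩ := hx
  exact ⟨i, f, ⟨hf, hi⟩, hx⟩

theorem notMem_UH_erase {H : Finset (Finset N)} {e : Finset N} {x : UElem N}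
    (hx : x ∈ UHe H e) : x ∉ UH (H.erase e) := by
  intro hx'
  simp only [UHe, UH, UHi, UHie, Finset.mem_biUnion, Finset.mem_filter, Finset.mem_univ,
    Finset.mem_erase, Finset.mem_image, true_and] at hx hx'
  obtain ⟨i, -, k, -, rfl⟩ := hx
  obtain ⟨j, f, ⟨⟨hf, -⟩, -⟩, m, -, hm⟩ := hx'
  simp only [Prod.mk.injEq] at hm
  exact hf hm.2.1

/-- Without one of the agents of `e`, only the agents of `U(H \ {e})` matter. -/
theorem uw_eq_uw_erase (v : Finset N → ℝ) {H : Finset (Finset N)} {e : Finset N}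
    (heta : eta (H.erase e) = eta H) {l' : UElem N} (hl' : l' ∈ UHe H e)
    {S S' : Finset (UElem N)} (hS : l' ∉ S)
    (hSS' : ∀ x ∈ UH (H.erase e), x ∈ S ↔ x ∈ S') :
    uw v H S = uw v (H.erase e) S' := by
  have hHof : Hof H S = Hof (H.erase e) S' := by
    ext f
    simp only [Hof, Finset.mem_filter, Finset.mem_erase]
    have key : f ∈ H.erase e → (UHe H f ⊆ S ↔ UHe (H.erase e) f ⊆ S') := by
      intro hf
      rw [← UHe_congr heta f]
      exact forall₂_congr fun x hx => hSS' x (UHe_subset_UH hf hx)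
    constructor
    · rintro ⟨hf, hsub⟩
      have hne : f ≠ e := by
        rintro rfl
        exact hS (hsub hl')
      exact ⟨⟨hne, hf⟩, (key (Finset.mem_erase.2 ⟨hne, hf⟩)).1 hsub⟩
    · rintro ⟨⟨hne, hf⟩, hsub⟩
      exact ⟨hf, (key (Finset.mem_erase.2 ⟨hne, hf⟩)).2 hsub⟩
  simp only [uw, hHof]

/-- If `η(H \ {e}) = η(H)` and `l' ∈ U(H)(e)`, then every agent of
`Ū(H,l') = (U(H) \ {l'}) \ U(H \ {e})` is a null player of the subgame of `w` on
`U(H) \ {l'}`, has zero Shapley value there, and the remaining agents receive the same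
Shapley payoff as in the uniform hyperlink game of `(N, v, H \ {e})`. -/
theorem null_players_after_erasing_agent
    {N : Type*} [Fintype N] [DecidableEq N]
    (v : Finset N → ℝ) (H : Finset (Finset N))
    (hN : 2 ≤ Fintype.card N)
    (hv0 : v ∅ = 0) (hzn : ∀ i : N, v {i} = 0)
    (hH : ∀ e ∈ H, 1 < e.card)
    (e : Finset N) (he : e ∈ H) (heta : eta (H.erase e) = eta H)
    (l' : UElem N) (hl' : l' ∈ UHe H e) :
    (∀ l ∈ ((UH H).erase l') \ UH (H.erase e),
        ∀ K ⊆ UH H \ {l', l}, uw v H (insert l K) = uw v H K)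
    ∧ (∀ l : {x // x ∈ (UH H).erase l'}, l.val ∈ ((UH H).erase l') \ UH (H.erase e) →
        shapley (fun F : Finset {x // x ∈ (UH H).erase l'} =>
          uw v H (F.image Subtype.val)) l = 0)
    ∧ (∀ l : UElem N, ∀ (hl : l ∈ UH (H.erase e)) (hl2 : l ∈ (UH H).erase l'),
        shapley (fun F : Finset {x // x ∈ (UH H).erase l'} =>
          uw v H (F.image Subtype.val)) ⟨l, hl2⟩
          = shapley (uGame v (H.erase e)) ⟨l, hl⟩) := by
  have hnull : ∀ l ∈ ((UH H).erase l') \ UH (H.erase e), ∀ K : Finset (UElem N), l' ∉ K →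
      uw v H (insert l K) = uw v H K := by
    intro l hl K hK
    simp only [Finset.mem_sdiff, Finset.mem_erase] at hl
    rw [uw_eq_uw_erase v heta hl' hK fun _ _ => Iff.rfl]
    refine uw_eq_uw_erase v heta hl' ?_ fun x hx => ?_
    · simp only [Finset.mem_insert, not_or]
      exact ⟨hl.1.1.symm, hK⟩
    · have hxl : x ≠ l := fun h => hl.2 (h ▸ hx)
      simp [hxl]
  have himage : ∀ F : Finset {x // x ∈ (UH H).erase l'}, l' ∉ F.image Subtype.val := by
    simp
  refine ⟨fun l hl K hK => hnull l hl K fun h => ?_, fun l hl => ?_, fun l hl hl2 => ?_⟩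
  · simpa using hK h
  · refine shapley_eq_zero_of_null _ _ fun F _ => ?_
    simp only [Finset.image_insert]
    exact hnull _ hl _ (himage F)
  · have hsub : ∀ x, x ∈ UH (H.erase e) → x ∈ (UH H).erase l' := fun x hx =>
      Finset.mem_erase.2
        ⟨fun h => notMem_UH_erase hl' (h ▸ hx), UH_erase_subset heta hx⟩
    refine shapley_eq_of_carrier (Subtype.impEmbedding _ _ hsub) _ (uGame v (H.erase e))
      (fun F F' hF => ?_) ⟨l, hl⟩
    refine uw_eq_uw_erase v heta hl' (himage F) fun x hx => ?_
    have hmem : (⟨x, hx⟩ : {x // x ∈ UH (H.erase e)}) ∈ F' ↔ ⟨x, hsub x hx⟩ ∈ F := hF ⟨x, hx⟩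
    rw [Finset.mem_image, Finset.mem_image]
    constructor
    · rintro ⟨y, hy, rfl⟩
      exact ⟨⟨y, hx⟩, hmem.2 hy, rfl⟩
    · rintro ⟨y, hy, rfl⟩
      exact ⟨⟨y, hsub y hx⟩, hmem.1 hy, rfl⟩

end HGGame
end
end
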